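/- Let N be an even natural number and let k satisfy k ≤ N/2. Let T be a finite set of size N. Draw F as a uniformly random (N/2)-subset of T and set O = T \ F. Conditionally on F, draw A as a uniformly random k-subset of F and, independently, B as a uniformly random k-subset of O; since F and O are disjoint, |A ∪ B| = 2k. Finally draw S as a uniformly random k-subset of A ∪ B. Then for every fixed element x ∈ T, the probability that x ∈ S equals k/N. -/

import Mathlib

open scoped ENNReal

/-- The uniform distribution on the `k`-element subsets of a finset `C`
(totalized by returning `∅` when `C` has fewer than `k` elements; this branch is
never taken in the theorem below). -/
noncomputable def uniformPowersetCard {α : Type*} (k : ℕ) (C : Finset α) :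
    PMF (Finset α) :=
  if h : (C.powersetCard k).Nonempty then PMF.uniformOfFinset (C.powersetCard k) h
  else PMF.pure ∅

open Finset in
/-- Double counting: `|C| * #{k-subsets of C containing x} = k * #{k-subsets of C}`. -/
theorem card_mul_card_filter_mem_powersetCard {α : Type*} [DecidableEq α] {C : Finset α} {x : α}
    (hx : x ∈ C) {k : ℕ} (hk : k ≤ #C) :
    #C * #{S ∈ C.powersetCard k | x ∈ S} = k * #(C.powersetCard k) := by
  have hcompl : {S ∈ C.powersetCard k | x ∉ S} = (C.erase x).powersetCard k := by
    ext S
    simp only [mem_filter, mem_powersetCard, subset_erase]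
    tauto
  have hsum := card_filter_add_card_filter_not (s := C.powersetCard k) (fun S => x ∈ S)
  obtain ⟨n, hn⟩ : ∃ n, #C = n + 1 := ⟨#C - 1, by have := card_pos.mpr ⟨x, hx⟩; omega⟩
  rw [hcompl, card_powersetCard, card_powersetCard, card_erase_of_mem hx, hn,
    Nat.add_sub_cancel] at hsum
  have hchoose := Nat.choose_mul_succ_eq n k
  rw [card_powersetCard, hn]
  rw [hn] at hk
  zify [hk] at hsum hchoose ⊢
  linear_combination (n + 1 : ℤ) * hsum - hchoose

theorem uniformPowersetCard_eq_uniformOfFinset {α : Type*} {k : ℕ} {C : Finset α}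
    (hk : k ≤ C.card) :
    uniformPowersetCard k C =
      PMF.uniformOfFinset (C.powersetCard k) (Finset.powersetCard_nonempty.mpr hk) :=
  dif_pos _

theorem mem_support_uniformPowersetCard {α : Type*} {k : ℕ} {C : Finset α} (hk : k ≤ C.card)
    {S : Finset α} : S ∈ (uniformPowersetCard k C).support ↔ S ⊆ C ∧ S.card = k := by
  rw [uniformPowersetCard_eq_uniformOfFinset hk, PMF.mem_support_uniformOfFinset_iff,
    Finset.mem_powersetCard]

/-- A fixed element of `C` lies in a uniform `k`-subset of `C` with probability `k / |C|`. -/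
theorem uniformPowersetCard_mem_prob {α : Type*} {k : ℕ} {C : Finset α} (hk : k ≤ C.card)
    {x : α} (hx : x ∈ C) :
    (uniformPowersetCard k C).toOuterMeasure {S | x ∈ S} = (k : ℝ≥0∞) / C.card := by
  classical
  rw [uniformPowersetCard_eq_uniformOfFinset hk, PMF.toOuterMeasure_uniformOfFinset_apply]
  have hcount := card_mul_card_filter_mem_powersetCard hx hk
  have hC : (C.card : ℝ≥0∞) ≠ 0 := by exact_mod_cast (Finset.card_pos.mpr ⟨x, hx⟩).ne'
  have hP : ((C.powersetCard k).card : ℝ≥0∞) ≠ 0 := by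
    exact_mod_cast (Finset.card_pos.mpr (Finset.powersetCard_nonempty.mpr hk)).ne'
  rw [ENNReal.div_eq_div_iff hC (by simp) hP (by simp)]
  simp only [Set.mem_ofPred_eq]
  rw [mul_comm (Finset.card (Finset.powersetCard k C) : ℝ≥0∞)]
  exact_mod_cast hcount

theorem uniformPowersetCard_mem_prob_of_notMem {α : Type*} {k : ℕ} {C : Finset α}
    (hk : k ≤ C.card) {x : α} (hx : x ∉ C) :
    (uniformPowersetCard k C).toOuterMeasure {S | x ∈ S} = 0 := by
  rw [PMF.toOuterMeasure_apply_eq_zero_iff, Set.disjoint_left]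
  exact fun S hS hxS => hx (((mem_support_uniformPowersetCard hk).mp hS).1 hxS)

theorem PMF.toOuterMeasure_bind_eq_mul {α β : Type*} {p : PMF α} {f : α → PMF β} {s : Set β}
    {t : Set α} {c : ℝ≥0∞} (hmem : ∀ a ∈ p.support, a ∈ t → (f a).toOuterMeasure s = c)
    (hnot : ∀ a ∈ p.support, a ∉ t → (f a).toOuterMeasure s = 0) :
    (p.bind f).toOuterMeasure s = p.toOuterMeasure t * c := by
  classical
  rw [PMF.toOuterMeasure_bind_apply, PMF.toOuterMeasure_apply, ← ENNReal.tsum_mul_right]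
  refine tsum_congr fun a => ?_
  by_cases ha : a ∈ p.support
  · by_cases hat : a ∈ t
    · simp [hmem a ha hat, hat]
    · simp [hnot a ha hat, hat]
  · have h0 : p a = 0 := (p.apply_eq_zero_iff a).mpr ha
    simp [h0, Set.indicator_apply]

theorem PMF.toOuterMeasure_bind_of_forall_eq {α β : Type*} {p : PMF α} {f : α → PMF β}
    {s : Set β} {c : ℝ≥0∞} (h : ∀ a ∈ p.support, (f a).toOuterMeasure s = c) :
    (p.bind f).toOuterMeasure s = c := by
  rw [PMF.toOuterMeasure_bind_eq_mul (t := Set.univ) (fun a ha _ => h a ha) (by simp),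
    (p.toOuterMeasure_apply_eq_one_iff Set.univ).mpr (Set.subset_univ _), one_mul]

/-- Selecting `k` out of `k + k` elements drawn from two disjoint sets of size `m` includes each
element of their union with probability `k / (m + m)`. -/
theorem two_stage_selection_mem_prob {α : Type*} [DecidableEq α] {F O : Finset α} {k m : ℕ}
    (hF : F.card = m) (hO : O.card = m) (hFO : Disjoint F O) (hk : k ≤ m) {x : α}
    (hx : x ∈ F ∪ O) :
    ((uniformPowersetCard k F).bind fun A => (uniformPowersetCard k O).bind fun B =>
      uniformPowersetCard k (A ∪ B)).toOuterMeasure {S | x ∈ S} =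
        (k : ℝ≥0∞) / ((m + m : ℕ) : ℝ≥0∞) := by
  have hkF : k ≤ F.card := hF ▸ hk
  have hkO : k ≤ O.card := hO ▸ hk
  have hm : (m : ℝ≥0∞) ≠ 0 := by
    rintro h
    obtain rfl : m = 0 := by exact_mod_cast h
    simp_all
  have hcard : ∀ A ∈ (uniformPowersetCard k F).support,
      ∀ B ∈ (uniformPowersetCard k O).support, (A ∪ B).card = k + k := by
    intro A hA B hB
    rw [mem_support_uniformPowersetCard hkF] at hA
    rw [mem_support_uniformPowersetCard hkO] at hB
    rw [Finset.card_union_of_disjoint (hFO.mono hA.1 hB.1), hA.2, hB.2]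
  have hprob : ∀ A ∈ (uniformPowersetCard k F).support,
      ∀ B ∈ (uniformPowersetCard k O).support, x ∈ A ∪ B →
      (uniformPowersetCard k (A ∪ B)).toOuterMeasure {S | x ∈ S} =
        (k : ℝ≥0∞) / ((k + k : ℕ) : ℝ≥0∞) := by
    intro A hA B hB hxAB
    have hc := hcard A hA B hB
    rw [uniformPowersetCard_mem_prob (by omega) hxAB, hc]
  have hzero : ∀ A ∈ (uniformPowersetCard k F).support,
      ∀ B ∈ (uniformPowersetCard k O).support, x ∉ A ∪ B →
      (uniformPowersetCard k (A ∪ B)).toOuterMeasure {S | x ∈ S} = 0 := by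
    intro A hA B hB hxAB
    have hc := hcard A hA B hB
    exact uniformPowersetCard_mem_prob_of_notMem (by omega) hxAB
  have harith : (k : ℝ≥0∞) / m * ((k : ℝ≥0∞) / ((k + k : ℕ) : ℝ≥0∞)) =
      (k : ℝ≥0∞) / ((m + m : ℕ) : ℝ≥0∞) := by
    rcases Nat.eq_zero_or_pos k with rfl | hkpos
    · simp
    · have hmpos : 0 < m := by omega
      rw [← ENNReal.toReal_eq_toReal_iff'
        (ENNReal.mul_ne_top (ENNReal.div_ne_top (by simp) hm)
          (ENNReal.div_ne_top (by simp) (by norm_cast; omega)))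
        (ENNReal.div_ne_top (by simp) (by norm_cast; omega))]
      simp only [ENNReal.toReal_mul, ENNReal.toReal_div, ENNReal.toReal_natCast]
      push_cast
      field_simp
  rcases Finset.mem_union.mp hx with hxF | hxO
  · have hxO : x ∉ O := Finset.disjoint_left.mp hFO hxF
    have hxB : ∀ B ∈ (uniformPowersetCard k O).support, x ∉ B := fun B hB h =>
      hxO (((mem_support_uniformPowersetCard hkO).mp hB).1 h)
    rw [PMF.toOuterMeasure_bind_eq_mul (t := {A | x ∈ A})
      (c := (k : ℝ≥0∞) / ((k + k : ℕ) : ℝ≥0∞)), uniformPowersetCard_mem_prob hkF hxF, hF, harith]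
    · exact fun A hA hxA => PMF.toOuterMeasure_bind_of_forall_eq fun B hB =>
        hprob A hA B hB (Finset.mem_union_left _ hxA)
    · exact fun A hA hxA => PMF.toOuterMeasure_bind_of_forall_eq fun B hB =>
        hzero A hA B hB (Finset.notMem_union.mpr ⟨hxA, hxB B hB⟩)
  · have hxF : x ∉ F := Finset.disjoint_right.mp hFO hxO
    refine PMF.toOuterMeasure_bind_of_forall_eq fun A hA => ?_
    have hxA : x ∉ A := fun h => hxF (((mem_support_uniformPowersetCard hkF).mp hA).1 h)
    rw [PMF.toOuterMeasure_bind_eq_mul (t := {B | x ∈ B})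
      (c := (k : ℝ≥0∞) / ((k + k : ℕ) : ℝ≥0∞)), uniformPowersetCard_mem_prob hkO hxO, hO, harith]
    · exact fun B hB hxB => hprob A hA B hB (Finset.mem_union_right _ hxB)
    · exact fun B hB hxB => hzero A hA B hB (Finset.notMem_union.mpr ⟨hxA, hxB⟩)

/-- Lemma 3 of the paper (corrected free-block selection): let `N` be even, `k ≤ N / 2`,
and `T` a finite set of size `N`. Draw `F` as a uniformly random `(N/2)`-subset of `T`
(the free blocks), set `O = T \ F` (the occupied blocks); conditionally on `F`,
independently draw `A` a uniformly random `k`-subset of `F` and `B` a uniformly random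
`k`-subset of `O` (so `|A ∪ B| = 2k`), and finally draw `S` as a uniformly random
`k`-subset of `A ∪ B`. Then for every fixed `x ∈ T`, the probability that `x ∈ S`
equals `k / N`. -/
theorem datalair_lemma3_selection_mem_prob {α : Type*} [DecidableEq α] (T : Finset α)
    (N k : ℕ) (hN : Even N) (hk : k ≤ N / 2) (hT : T.card = N) (x : α) (hx : x ∈ T) :
    ((PMF.uniformOfFinset (T.powersetCard (N / 2))
          (Finset.powersetCard_nonempty.mpr (by rw [hT]; exact Nat.div_le_self N 2))).bind
        (fun F => (uniformPowersetCard k F).bind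
          (fun A => (uniformPowersetCard k (T \ F)).bind
            (fun B => uniformPowersetCard k (A ∪ B))))).toOuterMeasure
      {S : Finset α | x ∈ S} = (k : ℝ≥0∞) / (N : ℝ≥0∞) := by
  refine PMF.toOuterMeasure_bind_of_forall_eq fun F hF => ?_
  rw [PMF.mem_support_uniformOfFinset_iff, Finset.mem_powersetCard] at hF
  obtain ⟨hFT, hFcard⟩ := hF
  obtain ⟨m, rfl⟩ := hN
  have hm : (m + m) / 2 = m := by omega
  rw [hm] at hk hFcard
  have hOcard : (T \ F).card = m := by
    rw [Finset.card_sdiff_of_subset hFT, hT, hFcard, Nat.add_sub_cancel]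
  exact two_stage_selection_mem_prob hFcard hOcard Finset.disjoint_sdiff hk
    (by rwa [Finset.union_sdiff_of_subset hFT])
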